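/- Let μ be the uniform probability measure on {-1,1}^n and let ν = e^f dμ be a probability measure on {-1,1}^n. For x ∈ {-1,1}^n let ∂_i f(x) = (f(x_+) - f(x_-))/2 where x_± agree with x except that the i-th coordinate is ±1. Define I₁(s) = ((1+s)/2)·log(1+s) + ((1-s)/2)·log(1-s) for s ∈ [-1,1]. Then H(ν|μ) ≤ ∫ Σ_{i=1}^n I₁( tanh(∂_i f(x)) ) dν(x). -/

import Mathlib

open MeasureTheory Real Set ENNReal
open scoped Classical

/-- The transportation cost `W_c(ν, μ)`: infimum of `∫ c dπ` over all couplings `π`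
of `ν` and `μ`. -/
noncomputable def transportCost {E F : Type*} [MeasurableSpace E] [MeasurableSpace F]
    (c : E → F → ℝ≥0∞) (ν : Measure E) (μ : Measure F) : ℝ≥0∞ :=
  ⨅ (P : Measure (E × F)) (_ : P.map Prod.fst = ν) (_ : P.map Prod.snd = μ),
    ∫⁻ p, c p.1 p.2 ∂P

/-- The relative entropy `H(ν|μ) = ∫ log (dν/dμ) dν` if `ν ≪ μ` (and the integral is
well defined), and `+∞` otherwise.  (Since the negative part of `log (dν/dμ)` is always
`ν`-integrable for probability measures, non-integrability corresponds to `H = +∞`.) -/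

noncomputable def relEntropy {E : Type*} [MeasurableSpace E] (ν μ : Measure E) : ℝ≥0∞ :=
  if ν ≪ μ ∧ Integrable (fun x => Real.log ((ν.rnDeriv μ x).toReal)) ν
  then ENNReal.ofReal (∫ x, Real.log ((ν.rnDeriv μ x).toReal) ∂ν) else ⊤

/-- The uniform probability measure on the discrete hypercube `{-1,1}ⁿ`,
viewed as a measure on `ℝⁿ`. -/
noncomputable def cubeUniform (n : ℕ) : Measure (Fin n → ℝ) :=
  Measure.pi fun _ =>
    ((2 : ℝ≥0∞)⁻¹ • Measure.dirac (-1 : ℝ) + (2 : ℝ≥0∞)⁻¹ • Measure.dirac (1 : ℝ))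

/-- The vertices `{-1,1}ⁿ` of the hypercube. -/
def cubeVertices (n : ℕ) : Set (Fin n → ℝ) := {y | ∀ i, y i = -1 ∨ y i = 1}

/-- The discrete partial derivative `∂ᵢ f(x) = (f(x₊) - f(x₋))/2`, where `x_±` agree with
`x` except that the `i`-th coordinate is `±1`. -/
noncomputable def dpartial (n : ℕ) (f : (Fin n → ℝ) → ℝ) (i : Fin n) (x : Fin n → ℝ) : ℝ :=
  (f (Function.update x i 1) - f (Function.update x i (-1))) / 2

/-- `I₁(s) = ((1+s)/2) log (1+s) + ((1-s)/2) log (1-s)`. -/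
noncomputable def I1 (s : ℝ) : ℝ :=
  (1 + s) / 2 * Real.log (1 + s) + (1 - s) / 2 * Real.log (1 - s)

/-- The log-sum inequality for two terms. -/
lemma log_sum_inequality {a b A B : ℝ} (ha : 0 < a) (hb : 0 < b) (hA : 0 < A) (hB : 0 < B) :
    (a + b) * Real.log ((a + b) / (A + B)) ≤
      a * Real.log (a / A) + b * Real.log (b / B) := by
  have key : ∀ {u U : ℝ}, 0 < u → 0 < U →
      u * Real.log ((a + b) / (A + B)) + (u - U * ((a + b) / (A + B))) ≤
        u * Real.log (u / U) := by
    intro u U hu hU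
    have hr : 0 < (a + b) / (A + B) := by positivity
    have h := Real.log_le_sub_one_of_pos (x := (a + b) / (A + B) / (u / U)) (by positivity)
    rw [Real.log_div hr.ne' (by positivity)] at h
    have h' := mul_le_mul_of_nonneg_left h hu.le
    have e : u * ((a + b) / (A + B) / (u / U) - 1) = U * ((a + b) / (A + B)) - u := by
      field_simp
    linarith
  have e : A * ((a + b) / (A + B)) + B * ((a + b) / (A + B)) = a + b := by
    field_simp
  linarith [key ha hA, key hb hB]

lemma I1_nonneg {s : ℝ} (h₁ : -1 < s) (h₂ : s < 1) : 0 ≤ I1 s := by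
  have key : ∀ {t : ℝ}, 0 < t → (t - 1) / 2 ≤ t / 2 * Real.log t := by
    intro t ht
    have h := mul_le_mul_of_nonneg_left (Real.one_sub_inv_le_log_of_pos ht) (half_pos ht).le
    have e : t / 2 * (1 - t⁻¹) = (t - 1) / 2 := by field_simp
    linarith
  have hp := key (t := 1 + s) (by linarith)
  have hm := key (t := 1 - s) (by linarith)
  unfold I1
  linarith

/-- `I₁ ∘ tanh` is the relative entropy of a two-point measure with weights proportional
to `e^u, e^v`. -/
lemma add_mul_I1_tanh (u v : ℝ) :
    (Real.exp u + Real.exp v) * I1 (Real.tanh ((u - v) / 2)) =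
      Real.exp u * Real.log (Real.exp u / ((Real.exp u + Real.exp v) / 2)) +
        Real.exp v * Real.log (Real.exp v / ((Real.exp v + Real.exp u) / 2)) := by
  have hu : Real.exp u = Real.exp ((u + v) / 2) * Real.exp ((u - v) / 2) := by
    rw [← Real.exp_add]; ring_nf
  have hv : Real.exp v = Real.exp ((u + v) / 2) * Real.exp (-((u - v) / 2)) := by
    rw [← Real.exp_add]; ring_nf
  have htanh : Real.tanh ((u - v) / 2) =
      (Real.exp u - Real.exp v) / (Real.exp u + Real.exp v) := by
    rw [Real.tanh_eq, hu, hv, ← mul_sub, ← mul_add,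
      mul_div_mul_left _ _ (Real.exp_pos _).ne']
  have hpu := Real.exp_pos u
  have hpv := Real.exp_pos v
  have e₁ : 1 + Real.tanh ((u - v) / 2) = Real.exp u / ((Real.exp u + Real.exp v) / 2) := by
    rw [htanh]; field_simp; ring
  have e₂ : 1 - Real.tanh ((u - v) / 2) = Real.exp v / ((Real.exp v + Real.exp u) / 2) := by
    rw [htanh, add_comm (Real.exp v)]; field_simp; ring
  rw [I1, e₁, e₂, add_comm (Real.exp v)]
  field_simp

/-- Flip the `i`-th coordinate. -/
def flipCoord {n : ℕ} (i : Fin n) (x : Fin n → Bool) : Fin n → Bool :=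
  Function.update x i (!x i)

lemma flipCoord_involutive {n : ℕ} (i : Fin n) : Function.Involutive (flipCoord i) := by
  intro x
  simp [flipCoord]

lemma flipCoord_cons_zero {n : ℕ} (b : Bool) (y : Fin n → Bool) :
    flipCoord 0 (Fin.cons b y : Fin (n + 1) → Bool) = Fin.cons (!b) y := by
  simp [flipCoord, Fin.update_cons_zero]

lemma flipCoord_cons_succ {n : ℕ} (i : Fin n) (b : Bool) (y : Fin n → Bool) :
    flipCoord i.succ (Fin.cons b y : Fin (n + 1) → Bool) = Fin.cons b (flipCoord i y) := by
  simp [flipCoord, Fin.cons_update]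

lemma sum_bool_cons {n : ℕ} (F : (Fin (n + 1) → Bool) → ℝ) :
    ∑ x, F x = ∑ y : Fin n → Bool, (F (Fin.cons true y) + F (Fin.cons false y)) := by
  rw [← (Fin.consEquiv fun _ : Fin (n + 1) => Bool).sum_comp, Fintype.sum_prod_type,
    Fintype.sum_bool, ← Finset.sum_add_distrib]
  rfl

/-- Subadditivity of entropy on the discrete cube. -/
theorem entropy_le_sum_entropy_flipCoord (n : ℕ) (g : (Fin n → Bool) → ℝ) (hg : ∀ x, 0 < g x) :
    ∑ x, g x * Real.log (g x) - (∑ x, g x) * Real.log ((∑ x, g x) / 2 ^ n) ≤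
      ∑ i, ∑ x, g x * Real.log (g x / ((g x + g (flipCoord i x)) / 2)) := by
  induction n with
  | zero => simp
  | succ n ih =>
    set h : (Fin n → Bool) → ℝ := fun y => g (Fin.cons true y) + g (Fin.cons false y) with hh
    have hpos : ∀ y, 0 < h y := fun y => add_pos (hg _) (hg _)
    have hsum : ∑ x, g x = ∑ y, h y := sum_bool_cons g
    have hS : 0 < ∑ y, h y := Finset.sum_pos (fun y _ => hpos y) Finset.univ_nonempty
    have hlog : Real.log ((∑ y, h y) / 2 ^ (n + 1)) =
        Real.log ((∑ y, h y) / 2 ^ n) - Real.log 2 := by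
      rw [pow_succ, ← div_div, Real.log_div (by positivity) (by norm_num)]
    have hzero : ∑ x, g x * Real.log (g x / ((g x + g (flipCoord 0 x)) / 2)) =
        ∑ x, g x * Real.log (g x) + (∑ y, h y) * Real.log 2 - ∑ y, h y * Real.log (h y) := by
      rw [sum_bool_cons, sum_bool_cons, Finset.sum_mul, ← Finset.sum_add_distrib,
        ← Finset.sum_sub_distrib]
      refine Finset.sum_congr rfl fun y _ => ?_
      have ht := hg (Fin.cons true y)
      have hf := hg (Fin.cons false y)
      have e : g (Fin.cons false y) + g (Fin.cons true y) = h y := add_comm _ _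
      have e' : g (Fin.cons true y) + g (Fin.cons false y) = h y := rfl
      have hy := hpos y
      simp only [flipCoord_cons_zero, Bool.not_true, Bool.not_false, e, e']
      rw [Real.log_div ht.ne' (by positivity), Real.log_div hf.ne' (by positivity),
        Real.log_div hy.ne' (by norm_num), ← e']
      ring
    have hsucc : ∀ i : Fin n,
        ∑ y, h y * Real.log (h y / ((h y + h (flipCoord i y)) / 2)) ≤
          ∑ x, g x * Real.log (g x / ((g x + g (flipCoord i.succ x)) / 2)) := by
      intro i
      rw [sum_bool_cons]
      refine Finset.sum_le_sum fun y _ => ?_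
      simp only [flipCoord_cons_succ]
      have hp : ∀ b, 0 < (g (Fin.cons b y) + g (Fin.cons b (flipCoord i y))) / 2 :=
        fun b => half_pos (add_pos (hg _) (hg _))
      refine le_of_eq_of_le ?_
        (log_sum_inequality (hg (Fin.cons true y)) (hg (Fin.cons false y)) (hp true) (hp false))
      simp only [hh]
      ring_nf
    rw [Fin.sum_univ_succ, hzero, hsum, hlog]
    have := (ih h hpos).trans (Finset.sum_le_sum fun i _ => hsucc i)
    linarith

/-- The vertex of `{-1,1}ⁿ` with the given sign pattern. -/
def signVector {n : ℕ} (x : Fin n → Bool) : Fin n → ℝ := fun i => if x i then 1 else -1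

lemma signVector_update {n : ℕ} (x : Fin n → Bool) (i : Fin n) (b : Bool) :
    signVector (Function.update x i b) =
      Function.update (signVector x) i (if b then 1 else -1) := by
  ext j
  rcases eq_or_ne j i with rfl | hj
  · simp [signVector]
  · simp [signVector, hj]

lemma isProbabilityMeasure_signs : IsProbabilityMeasure
    ((2 : ℝ≥0∞)⁻¹ • Measure.dirac (-1 : ℝ) + (2 : ℝ≥0∞)⁻¹ • Measure.dirac (1 : ℝ)) :=
  ⟨by simp [ENNReal.inv_two_add_inv_two]⟩

lemma cubeUniform_eq_sum (n : ℕ) :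
    cubeUniform n =
      Measure.sum fun x : Fin n → Bool => (2 : ℝ≥0∞)⁻¹ ^ n • Measure.dirac (signVector x) := by
  have := isProbabilityMeasure_signs
  refine Measure.pi_eq fun s hs => ?_
  have hi : ∀ i, ((2 : ℝ≥0∞)⁻¹ • Measure.dirac (-1 : ℝ) +
      (2 : ℝ≥0∞)⁻¹ • Measure.dirac (1 : ℝ)) (s i) =
      ∑ b : Bool, (2 : ℝ≥0∞)⁻¹ * (s i).indicator 1 (if b then (1 : ℝ) else -1) := by
    intro i
    simp [Measure.dirac_apply' _ (hs i), add_comm]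
  rw [Measure.sum_apply _ (MeasurableSet.univ_pi hs), tsum_fintype]
  simp only [hi]
  rw [Finset.prod_univ_sum, Fintype.piFinset_univ]
  refine Finset.sum_congr rfl fun x _ => ?_
  rw [Finset.prod_mul_distrib, Finset.prod_const, Finset.card_univ, Fintype.card_fin,
    Measure.smul_apply, Measure.dirac_apply' _ (MeasurableSet.univ_pi hs), smul_eq_mul]
  congr 1
  by_cases hx : signVector x ∈ Set.univ.pi s
  · rw [Set.indicator_of_mem hx]
    refine (Finset.prod_eq_one fun i _ => ?_).symm
    exact Set.indicator_of_mem (hx i (Set.mem_univ i)) _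
  · rw [Set.indicator_of_notMem hx]
    obtain ⟨i, hxi⟩ : ∃ i, signVector x i ∉ s i := by simpa [Set.mem_pi] using hx
    exact (Finset.prod_eq_zero (Finset.mem_univ i) (Set.indicator_of_notMem hxi _)).symm

instance (n : ℕ) : IsProbabilityMeasure (cubeUniform n) := by
  have := isProbabilityMeasure_signs
  unfold cubeUniform
  infer_instance

lemma aemeasurable_cubeUniform {n : ℕ} {β : Type*} [MeasurableSpace β] (φ : (Fin n → ℝ) → β) :
    AEMeasurable φ (cubeUniform n) := by
  rw [cubeUniform_eq_sum]
  exact AEMeasurable.sum_measure fun x => aemeasurable_dirac.smul_measure _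

lemma integrable_cubeUniform {n : ℕ} (φ : (Fin n → ℝ) → ℝ) :
    Integrable φ (cubeUniform n) := by
  rw [cubeUniform_eq_sum, Measure.sum_fintype, integrable_finsetSum_measure]
  intro x _
  exact (integrable_dirac (by simp)).smul_measure (by simp)

lemma integral_cubeUniform {n : ℕ} (φ : (Fin n → ℝ) → ℝ) :
    ∫ y, φ y ∂cubeUniform n = (2⁻¹ : ℝ) ^ n * ∑ x, φ (signVector x) := by
  have hint := integrable_cubeUniform φ
  rw [cubeUniform_eq_sum, Measure.sum_fintype] at hint ⊢
  rw [integral_finsetSum_measure (integrable_finsetSum_measure.1 hint), Finset.mul_sum]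
  simp [integral_smul_measure, integral_dirac]

lemma integrable_withDensity_cubeUniform {n : ℕ} (f φ : (Fin n → ℝ) → ℝ) :
    Integrable φ ((cubeUniform n).withDensity fun x => ENNReal.ofReal (Real.exp (f x))) := by
  rw [integrable_withDensity_iff_integrable_smul₀' (aemeasurable_cubeUniform _) (by simp)]
  exact integrable_cubeUniform _

lemma integral_withDensity_cubeUniform {n : ℕ} (f φ : (Fin n → ℝ) → ℝ) :
    ∫ y, φ y ∂((cubeUniform n).withDensity fun x => ENNReal.ofReal (Real.exp (f x))) =
      (2⁻¹ : ℝ) ^ n * ∑ x, Real.exp (f (signVector x)) * φ (signVector x) := by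
  rw [integral_withDensity_eq_integral_toReal_smul₀ (aemeasurable_cubeUniform _) (by simp),
    integral_cubeUniform]
  simp [ENNReal.toReal_ofReal (Real.exp_nonneg _)]

lemma toReal_relEntropy_cubeUniform {n : ℕ} (f : (Fin n → ℝ) → ℝ) :
    (relEntropy ((cubeUniform n).withDensity fun x => ENNReal.ofReal (Real.exp (f x)))
        (cubeUniform n)).toReal =
      max (∫ x, f x ∂((cubeUniform n).withDensity fun x => ENNReal.ofReal (Real.exp (f x))))
        0 := by
  have hac := withDensity_absolutelyContinuous (cubeUniform n)
    fun x => ENNReal.ofReal (Real.exp (f x))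
  have hae := hac.ae_le (Measure.rnDeriv_withDensity₀ (cubeUniform n)
    (aemeasurable_cubeUniform fun x => ENNReal.ofReal (Real.exp (f x))))
  rw [relEntropy, if_pos ⟨hac, integrable_withDensity_cubeUniform f _⟩, ENNReal.toReal_ofReal']
  congr 1
  refine integral_congr_ae ?_
  filter_upwards [hae] with x hx
  rw [hx, ENNReal.toReal_ofReal (Real.exp_nonneg _), Real.log_exp]

lemma sum_exp_mul_I1_tanh_dpartial {n : ℕ} (f : (Fin n → ℝ) → ℝ) (i : Fin n) :
    ∑ x : Fin n → Bool, Real.exp (f (signVector x)) *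
        I1 (Real.tanh (dpartial n f i (signVector x))) =
      ∑ x : Fin n → Bool, Real.exp (f (signVector x)) *
        Real.log (Real.exp (f (signVector x)) / ((Real.exp (f (signVector x)) +
          Real.exp (f (signVector (flipCoord i x)))) / 2)) := by
  have hsymm : ∀ F : (Fin n → Bool) → ℝ,
      2 * ∑ x, F x = ∑ x, (F x + F (flipCoord i x)) := by
    intro F
    rw [Finset.sum_add_distrib, (flipCoord_involutive i).bijective.sum_comp F, two_mul]
  refine mul_left_cancel₀ (two_ne_zero (α := ℝ)) ?_
  rw [hsymm, hsymm]
  refine Finset.sum_congr rfl fun x _ => ?_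
  rw [flipCoord_involutive i x]
  have hd : ∀ z : Fin n → Bool, dpartial n f i (signVector z) =
      (f (signVector (Function.update z i true)) -
        f (signVector (Function.update z i false))) / 2 := by
    intro z
    simp [dpartial, signVector_update]
  have hflip : dpartial n f i (signVector (flipCoord i x)) = dpartial n f i (signVector x) := by
    simp [hd, flipCoord]
  rw [hflip, ← add_mul, hd]
  cases hx : x i
  · have h₁ : Function.update x i false = x := by rw [← hx, Function.update_eq_self]
    have h₂ : flipCoord i x = Function.update x i true := by simp [flipCoord, hx]
    rw [h₁, h₂, add_comm (Real.exp (f (signVector x))), add_mul_I1_tanh, add_comm,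
      add_comm (Real.exp (f (signVector x)))]
  · have h₁ : Function.update x i true = x := by rw [← hx, Function.update_eq_self]
    have h₂ : flipCoord i x = Function.update x i false := by simp [flipCoord, hx]
    rw [h₁, h₂, add_mul_I1_tanh]

/-- **Improved log-Sobolev inequality on the discrete hypercube.** For every probability
measure `ν = e^f dμ` on `{-1,1}ⁿ`,
`H(ν|μ) ≤ ∫ ∑ i, I₁(tanh (∂ᵢ f(x))) dν(x)`. -/
theorem improved_logSobolev_cube (n : ℕ) (f : (Fin n → ℝ) → ℝ) (ν : Measure (Fin n → ℝ))
    (hν : ν = (cubeUniform n).withDensity (fun x => ENNReal.ofReal (Real.exp (f x))))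
    (hprob : IsProbabilityMeasure ν) :
    (relEntropy ν (cubeUniform n)).toReal ≤
      ∫ x, ∑ i, I1 (Real.tanh (dpartial n f i x)) ∂ν := by
  subst hν
  have htotal : ∑ x : Fin n → Bool, Real.exp (f (signVector x)) = 2 ^ n := by
    have h := integral_withDensity_cubeUniform f fun _ => 1
    simp only [integral_const, probReal_univ, smul_eq_mul, mul_one, inv_pow] at h
    field_simp at h
    exact h.symm
  rw [toReal_relEntropy_cubeUniform]
  refine max_le ?_ (integral_nonneg fun x => Finset.sum_nonneg fun i _ =>
    I1_nonneg (Real.neg_one_lt_tanh _) (Real.tanh_lt_one _))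
  rw [integral_withDensity_cubeUniform, integral_withDensity_cubeUniform]
  refine mul_le_mul_of_nonneg_left ?_ (by positivity)
  have h := entropy_le_sum_entropy_flipCoord n (fun x => Real.exp (f (signVector x)))
    fun x => Real.exp_pos _
  simp only [htotal, Real.log_exp, ← sum_exp_mul_I1_tanh_dpartial] at h
  rw [div_self (by positivity), Real.log_one, mul_zero, sub_zero] at h
  simpa only [Finset.mul_sum, Finset.sum_comm (s := (Finset.univ : Finset (Fin n)))] using h
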